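/- arXiv:1911.06853 — 3 statements merged into one kernel-verified Lean document; each statement's English description precedes it below -/
import Mathlib

section
/- For every real r > 0, either the subgroup G_r of SL(2,ℝ) generated by A_r and R is discrete (the subspace topology on G_r is discrete), or G_r is dense in SL(2,ℝ) (its topological closure is all of SL(2,ℝ)). -/
open Real Matrix
open scoped MatrixGroups UpperHalfPlane

noncomputable instance : TopologicalSpace SL(2,ℝ) :=
  TopologicalSpace.induced (fun g => (g : Matrix (Fin 2) (Fin 2) ℝ)) inferInstance

/-- Inverse hyperbolic cosine: `arcosh x = log (x + sqrt (x ^ 2 - 1))`. -/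
noncomputable def arcosh (x : ℝ) : ℝ := Real.log (x + Real.sqrt (x ^ 2 - 1))

/-- The hyperbolic translation of distance `r` along the imaginary axis. -/
noncomputable def A (r : ℝ) : SL(2, ℝ) :=
  ⟨!![Real.exp (r / 2), 0; 0, Real.exp (-(r / 2))], by
    simp [Matrix.det_fin_two_of, ← Real.exp_add]⟩

/-- The clockwise rotation by a right angle fixing `i`. -/
noncomputable def R : SL(2, ℝ) :=
  ⟨(Real.sqrt 2)⁻¹ • !![1, -1; 1, 1], by
    have h : (Real.sqrt 2) ^ 2 = 2 := Real.sq_sqrt (by norm_num)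
    simp [Matrix.det_smul, Matrix.det_fin_two_of, inv_pow, h]
    rw [← mul_inv, Real.mul_self_sqrt (by norm_num : (0:ℝ) ≤ 2)]
    norm_num⟩

/-- The group generated by `A r` and `R`. -/
noncomputable def G (r : ℝ) : Subgroup SL(2, ℝ) := Subgroup.closure {A r, R}


section BanachAlgebra

open Filter Topology

variable {𝔸 : Type*} [NormedRing 𝔸] [NormedAlgebra ℝ 𝔸]

lemma exp_eq_one_add_of_mul_self_eq_zero {N : 𝔸} (hN : N * N = 0) :
    NormedSpace.exp N = 1 + N := by
  rw [NormedSpace.exp_eq_tsum ℝ]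
  have h : ∀ n ∉ Finset.range 2, ((n.factorial : ℝ)⁻¹) • N ^ n = 0 := by
    intro n hn
    obtain ⟨k, rfl⟩ : ∃ k, n = 2 + k := ⟨n - 2, by simp at hn; omega⟩
    simp [pow_add, pow_two, hN]
  simp only
  rw [tsum_eq_sum h]
  simp [Finset.sum_range_succ]

variable [CompleteSpace 𝔸]

/-- A product of `k n` factors `1 + x n` with `k n • x n → Y` and `x n → 0` tends to `exp Y`. -/
lemma tendsto_one_add_pow_exp {x : ℕ → 𝔸} {k : ℕ → ℕ} {Y : 𝔸} (hx : Tendsto x atTop (𝓝 0))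
    (hk : Tendsto (fun n => (k n : ℝ) • x n) atTop (𝓝 Y)) :
    Tendsto (fun n => (1 + x n) ^ k n) atTop (𝓝 (NormedSpace.exp Y)) := by
  let _ : NormedAlgebra ℚ 𝔸 := NormedAlgebra.restrictScalars ℚ ℝ 𝔸
  have hf : HasStrictFDerivAt (NormedSpace.exp : 𝔸 → 𝔸)
      ((ContinuousLinearEquiv.refl ℝ 𝔸 : 𝔸 ≃L[ℝ] 𝔸) : 𝔸 →L[ℝ] 𝔸) 0 :=
    hasStrictFDerivAt_exp_zero
  set L := hf.localInverse
  have hL := hf.to_localInverse.hasFDerivAt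
  have hL0 := hf.localInverse_apply_image
  have hr := hf.eventually_right_inverse
  rw [NormedSpace.exp_zero] at hL hL0 hr
  have hlim := hL.hasFDerivWithinAt (s := Set.univ) |>.lim hx (by simp) hk
  have hx1 : Tendsto (fun n => 1 + x n) atTop (𝓝 1) := by simpa using hx.const_add 1
  have hev := hx1.eventually hr
  rw [hL0] at hlim
  have h2 := (NormedSpace.exp_continuous (𝔸 := 𝔸)).tendsto _ |>.comp hlim
  refine (h2.congr' ?_).trans (by simp)
  filter_upwards [hev] with n hn
  simp only [Function.comp, sub_zero]
  rw [Nat.cast_smul_eq_nsmul, NormedSpace.exp_nsmul, hn]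

lemma exp_smul_mul_exp_neg_smul (X : 𝔸) (t : ℝ) :
    NormedSpace.exp (t • X) * NormedSpace.exp (-t • X) = 1 := by
  let _ : NormedAlgebra ℚ 𝔸 := NormedAlgebra.restrictScalars ℚ ℝ 𝔸
  rw [← NormedSpace.exp_add_of_commute (((Commute.refl X).smul_right _).smul_left _)]
  simp

/-- The generators of the one-parameter groups contained in a closed submonoid. -/
def tangentSpace (S : Submonoid 𝔸) (hS : IsClosed (S : Set 𝔸)) : Submodule ℝ 𝔸 where
  carrier := {X | ∀ t : ℝ, NormedSpace.exp (t • X) ∈ S}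
  zero_mem' := by simp
  smul_mem' c X hX t := by simpa [smul_smul] using hX (t * c)
  add_mem' {X Y} hX hY t := by
    let _ : NormedAlgebra ℚ 𝔸 := NormedAlgebra.restrictScalars ℚ ℝ 𝔸
    let u : ℕ → ℝ := fun n => t / (n + 1)
    have hu : Tendsto u atTop (𝓝 0) := tendsto_const_div_atTop_nhds_zero_nat t |>.comp
      (tendsto_add_atTop_nat 1) |>.congr (by simp [u])
    let f : ℝ → 𝔸 := fun s => NormedSpace.exp (s • X) * NormedSpace.exp (s • Y)
    have hf : HasDerivAt f (X + Y) 0 := by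
      have h1 := hasDerivAt_exp_smul_const (𝕂 := ℝ) X (0 : ℝ)
      have h2 := hasDerivAt_exp_smul_const (𝕂 := ℝ) Y (0 : ℝ)
      have h3 := h1.mul h2
      simp only [zero_smul, NormedSpace.exp_zero, one_mul, mul_one] at h3
      exact h3
    have hf0 : f 0 = 1 := by simp [f]
    have hlim := tendsto_one_add_pow_exp (x := fun n => f (u n) - 1) (k := fun n => n + 1)
      (Y := t • (X + Y)) ?_ ?_
    · refine hS.mem_of_tendsto hlim (Eventually.of_forall fun n => ?_)
      simp only [add_sub_cancel]
      exact S.pow_mem (S.mul_mem (hX _) (hY _)) _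
    · have := (hf.continuousAt.tendsto.comp hu).sub_const 1
      simpa [hf0] using this
    · have := hf.hasFDerivAt.hasFDerivWithinAt (s := Set.univ) |>.lim (c := fun n : ℕ => (n : ℝ) + 1)
        (v := t) hu (by simp) (tendsto_const_nhds.congr fun n => by
          simp only [u, smul_eq_mul]; field_simp)
      simpa [hf0] using this

lemma mem_tangentSpace {S : Submonoid 𝔸} {hS : IsClosed (S : Set 𝔸)} {X : 𝔸} :
    X ∈ tangentSpace S hS ↔ ∀ t : ℝ, NormedSpace.exp (t • X) ∈ S := Iff.rfl

lemma conj_mem_tangentSpace {S : Submonoid 𝔸} {hS : IsClosed (S : Set 𝔸)} {X : 𝔸}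
    (hX : X ∈ tangentSpace S hS) (u : 𝔸ˣ) (hu : (u : 𝔸) ∈ S) (hu' : ((u⁻¹ : 𝔸ˣ) : 𝔸) ∈ S) :
    (u : 𝔸) * X * ((u⁻¹ : 𝔸ˣ) : 𝔸) ∈ tangentSpace S hS := by
  let _ : NormedAlgebra ℚ 𝔸 := NormedAlgebra.restrictScalars ℚ ℝ 𝔸
  intro t
  have := S.mul_mem (S.mul_mem hu (hX t)) hu'
  rwa [← NormedSpace.exp_units_conj, mul_smul_comm, smul_mul_assoc] at this

/-- A limit direction of elements of `S` converging to `1` is tangent to `S`. -/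
lemma mem_tangentSpace_of_tendsto {S : Submonoid 𝔸} (hS : IsClosed (S : Set 𝔸))
    (hinv : ∀ a ∈ S, ∃ b ∈ S, b * a = 1) {x : ℕ → 𝔸} {X : 𝔸} (hx : Tendsto x atTop (𝓝 0))
    (hx0 : ∀ n, x n ≠ 0) (hxS : ∀ n, 1 + x n ∈ S)
    (hX : Tendsto (fun n => ‖x n‖⁻¹ • x n) atTop (𝓝 X)) : X ∈ tangentSpace S hS := by
  have key : ∀ t : ℝ, 0 ≤ t → NormedSpace.exp (t • X) ∈ S := by
    intro t ht
    have hn0 : Tendsto (fun n => ‖x n‖) atTop (𝓝 0) := tendsto_zero_iff_norm_tendsto_zero.1 hx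
    have hk : Tendsto (fun n => (⌊t / ‖x n‖⌋₊ : ℝ) * ‖x n‖) atTop (𝓝 t) := by
      refine tendsto_of_tendsto_of_tendsto_of_le_of_le (g := fun n => t - ‖x n‖) (h := fun _ => t)
        (by simpa using hn0.const_sub t) tendsto_const_nhds (fun n => ?_) (fun n => ?_)
      · have hp := norm_pos_iff.2 (hx0 n)
        have h1 := Nat.lt_floor_add_one (t / ‖x n‖)
        rw [div_lt_iff₀ hp] at h1
        simp only
        linarith
      · have hp := norm_pos_iff.2 (hx0 n)
        exact (le_div_iff₀ hp).1 (Nat.floor_le (by positivity))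
    refine hS.mem_of_tendsto (tendsto_one_add_pow_exp hx (k := fun n => ⌊t / ‖x n‖⌋₊) ?_)
      (Eventually.of_forall fun n => S.pow_mem (hxS n) _)
    refine (hk.smul hX).congr fun n => ?_
    rw [smul_smul, mul_assoc, mul_inv_cancel₀ (norm_ne_zero_iff.2 (hx0 n)), mul_one]
  intro t
  rcases le_total 0 t with ht | ht
  · exact key t ht
  · obtain ⟨b, hb, hb1⟩ := hinv _ (key (-t) (by linarith))
    have h := exp_smul_mul_exp_neg_smul X (-t)
    rw [neg_neg] at h
    rwa [← left_inv_eq_right_inv hb1 h]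

end BanachAlgebra

section LinearAlgebra

/-- A subspace of `2 × 2` matrices that contains a nonzero traceless matrix and is invariant under
conjugation by a rotation by a right angle and by a nontrivial hyperbolic diagonal matrix contains
every off-diagonal matrix. -/
lemma offDiag_mem_of_invariant (h : Submodule ℝ (Matrix (Fin 2) (Fin 2) ℝ)) {e : ℝ} (he : 1 < e)
    (hA : ∀ a b c d : ℝ, !![a, b; c, d] ∈ h → !![a, e * b; e⁻¹ * c, d] ∈ h)
    (hR : ∀ a b c : ℝ, !![a, b; c, -a] ∈ h →
      !![-((b + c) / 2), (2 * a + b - c) / 2; (2 * a + c - b) / 2, (b + c) / 2] ∈ h)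
    {a b c : ℝ} (hX : !![a, b; c, -a] ∈ h) (hne : a ≠ 0 ∨ b ≠ 0 ∨ c ≠ 0) (s t : ℝ) :
    !![0, s; t, 0] ∈ h := by
  have he0 : e ≠ 0 := by positivity
  have hee : e ^ 2 - 1 ≠ 0 := by nlinarith
  have step : ∀ b c : ℝ, b ≠ 0 → c ≠ 0 → !![0, b; c, 0] ∈ h → !![0, s; t, 0] ∈ h := by
    intro b c hb hc hbc
    have h1 := hA _ _ _ _ hbc
    let y := (s / b - t / c) * e / (e ^ 2 - 1)
    have h2 := h.add_mem (h.smul_mem (s / b - y * e) hbc) (h.smul_mem y h1)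
    convert h2 using 1
    ext i j
    fin_cases i <;> fin_cases j <;> simp [y] <;> field_simp <;> ring
  by_cases hbc : b = c
  · subst hbc
    have h1 := h.add_mem (h.smul_mem b hX) (h.smul_mem a (hR _ _ _ hX))
    have h0 : a ^ 2 + b ^ 2 ≠ 0 := by
      rcases hne with h0 | h0 | h0 <;> positivity
    refine step _ _ h0 h0 ?_
    convert h1 using 1
    ext i j
    fin_cases i <;> fin_cases j <;> simp <;> ring
  · have h1 := hR _ _ _ hX
    have h2 := h.add_mem hX (hR (-((b + c) / 2)) _ _ (by simpa using h1))
    refine step (b - c) (c - b) (sub_ne_zero.2 hbc) (sub_ne_zero.2 (Ne.symm hbc)) ?_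
    convert h2 using 1
    ext i j
    fin_cases i <;> fin_cases j <;> simp <;> ring

lemma offDiag_mul_self (s t : ℝ) (hst : s * t = 0) : !![0, s; t, 0] * !![0, s; t, 0] = 0 := by
  ext i j
  fin_cases i <;> fin_cases j <;> simp [Matrix.mul_apply, -mul_eq_zero, hst, mul_comm t]

/-- The elementary matrices generate `SL(2, ℝ)`. -/
lemma mem_of_det_eq_one_of_transvection_mem (S : Submonoid (Matrix (Fin 2) (Fin 2) ℝ))
    (hU : ∀ s : ℝ, !![1, s; 0, 1] ∈ S) (hL : ∀ t : ℝ, !![1, 0; t, 1] ∈ S)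
    (g : Matrix (Fin 2) (Fin 2) ℝ) (hg : g.det = 1) : g ∈ S := by
  have key : ∀ a b c d : ℝ, a * d - b * c = 1 → c ≠ 0 → !![a, b; c, d] ∈ S := by
    intro a b c d hdet hc
    convert S.mul_mem (S.mul_mem (hU ((a - 1) / c)) (hL c)) (hU ((d - 1) / c)) using 1
    have hb : b = (a * d - 1) / c := by field_simp; linarith
    subst hb
    ext i j
    fin_cases i <;> fin_cases j <;> simp [Matrix.mul_apply] <;> field_simp <;> ring
  rw [Matrix.det_fin_two] at hg
  rw [Matrix.eta_fin_two g]
  by_cases hc : g 1 0 = 0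
  · have ha : g 0 0 ≠ 0 := by
      rintro ha
      simp [hc, ha] at hg
    convert S.mul_mem (hL (-1))
      (key (g 0 0) (g 0 1) (g 0 0) (g 0 1 + g 1 1) (by rw [hc] at hg; linarith) ha) using 1
    ext i j
    fin_cases i <;> fin_cases j <;> simp [Matrix.mul_apply, hc]
  · exact key _ _ _ _ hg hc

end LinearAlgebra

section ClosureInMatrices

open Filter Topology
open scoped Matrix.Norms.Operator

/-- The closure of a subgroup of `SL(2, ℝ)` in the space of all matrices. -/
noncomputable def matrixClosure (Γ : Subgroup SL(2, ℝ)) : Submonoid (Matrix (Fin 2) (Fin 2) ℝ) :=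
  Submonoid.topologicalClosure
    { carrier := (fun g : SL(2, ℝ) => (g : Matrix (Fin 2) (Fin 2) ℝ)) '' (Γ : Set SL(2, ℝ))
      one_mem' := ⟨1, Γ.one_mem, by simp⟩
      mul_mem' := by
        rintro _ _ ⟨g, hg, rfl⟩ ⟨k, hk, rfl⟩
        exact ⟨g * k, Γ.mul_mem hg hk, by simp⟩ }

lemma isClosed_matrixClosure (Γ : Subgroup SL(2, ℝ)) :
    IsClosed (matrixClosure Γ : Set (Matrix (Fin 2) (Fin 2) ℝ)) :=
  isClosed_closure

lemma coe_mem_matrixClosure {Γ : Subgroup SL(2, ℝ)} {g : SL(2, ℝ)} (hg : g ∈ Γ) :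
    (g : Matrix (Fin 2) (Fin 2) ℝ) ∈ matrixClosure Γ :=
  subset_closure ⟨g, hg, rfl⟩

lemma exists_left_inv_mem_matrixClosure {Γ : Subgroup SL(2, ℝ)} {a : Matrix (Fin 2) (Fin 2) ℝ}
    (ha : a ∈ matrixClosure Γ) : ∃ b ∈ matrixClosure Γ, b * a = 1 := by
  refine ⟨a.adjugate, ?_, ?_⟩
  · refine map_mem_closure (f := fun a : Matrix (Fin 2) (Fin 2) ℝ => a.adjugate)
      (continuous_id.matrix_adjugate) ha ?_
    rintro _ ⟨g, hg, rfl⟩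
    exact ⟨g⁻¹, Γ.inv_mem hg, by simp [Matrix.SpecialLinearGroup.coe_inv]⟩
  · have hdet : a.det = 1 := by
      have hc : IsClosed {m : Matrix (Fin 2) (Fin 2) ℝ | m.det = 1} :=
        isClosed_eq (continuous_id.matrix_det) continuous_const
      refine closure_minimal ?_ hc ha
      rintro _ ⟨g, hg, rfl⟩
      exact g.det_coe
    rw [Matrix.adjugate_mul, hdet, one_smul]

/-- A subgroup that is not discrete has elements different from `1` arbitrarily close to `1`. -/
lemma exists_seq_tendsto_of_not_discreteTopology {Γ : Subgroup SL(2, ℝ)}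
    (hΓ : ¬ DiscreteTopology Γ) :
    ∃ x : ℕ → Matrix (Fin 2) (Fin 2) ℝ, Tendsto x atTop (𝓝 0) ∧ (∀ n, x n ≠ 0) ∧
      ∀ n, ∃ g ∈ Γ, (g : Matrix (Fin 2) (Fin 2) ℝ) = 1 + x n := by
  have h : ∀ ε > 0, ∃ g ∈ Γ, ‖(g : Matrix (Fin 2) (Fin 2) ℝ) - 1‖ < ε ∧ g ≠ 1 := by
    by_contra! hcon
    obtain ⟨ε, hε, hcon⟩ := hcon
    refine hΓ (discreteTopology_iff_isOpen_singleton.2 fun g => ?_)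
    have hval : Continuous fun k : SL(2, ℝ) => (k : Matrix (Fin 2) (Fin 2) ℝ) :=
      continuous_induced_dom
    have hcont : Continuous fun k : Γ =>
        ‖((g⁻¹ : SL(2, ℝ)) : Matrix (Fin 2) (Fin 2) ℝ) *
          ((k : SL(2, ℝ)) : Matrix (Fin 2) (Fin 2) ℝ) - 1‖ :=
      ((continuous_const.mul (hval.comp continuous_subtype_val)).sub continuous_const).norm
    convert isOpen_lt hcont (continuous_const (y := ε)) using 1
    ext k
    constructor
    · rintro rfl
      simp only [Set.mem_ofPred_eq]
      rw [← Matrix.SpecialLinearGroup.coe_mul]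
      simpa using hε
    · intro hk
      simp only [Set.mem_ofPred_eq] at hk
      rw [← Matrix.SpecialLinearGroup.coe_mul] at hk
      have := hcon _ (Γ.mul_mem (Γ.inv_mem g.2) k.2) hk
      exact Subtype.ext (inv_mul_eq_one.1 this).symm
  choose g hg hg1 hg2 using fun n : ℕ => h (1 / ((n : ℝ) + 1)) Nat.one_div_pos_of_nat
  refine ⟨fun n => (g n : Matrix (Fin 2) (Fin 2) ℝ) - 1, ?_, fun n hn => hg2 n ?_,
    fun n => ⟨g n, hg n, by simp⟩⟩
  · exact squeeze_zero_norm (fun n => (hg1 n).le) tendsto_one_div_add_atTop_nhds_zero_nat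
  · exact Subtype.ext (by simpa using sub_eq_zero.1 hn)

lemma trace_eq_neg_det_of_det_one_add {x : Matrix (Fin 2) (Fin 2) ℝ} (hx : (1 + x).det = 1) :
    x.trace = -x.det := by
  simp only [Matrix.det_fin_two, Matrix.trace_fin_two, Matrix.add_apply] at hx ⊢
  simp at hx
  linarith

/-- The closure of a non-discrete subgroup has a nonzero traceless tangent vector. -/
lemma exists_mem_tangentSpace_of_not_discreteTopology {Γ : Subgroup SL(2, ℝ)}
    (hΓ : ¬ DiscreteTopology Γ) :
    ∃ X ∈ tangentSpace (matrixClosure Γ) (isClosed_matrixClosure Γ), X ≠ 0 ∧ X.trace = 0 := by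
  obtain ⟨x, hx, hx0, hxΓ⟩ := exists_seq_tendsto_of_not_discreteTopology hΓ
  have : ProperSpace (Matrix (Fin 2) (Fin 2) ℝ) := FiniteDimensional.proper ℝ _
  have hs : ∀ n, ‖x n‖⁻¹ • x n ∈ Metric.sphere (0 : Matrix (Fin 2) (Fin 2) ℝ) 1 := by
    intro n
    rw [mem_sphere_zero_iff_norm, norm_smul, norm_inv, norm_norm,
      inv_mul_cancel₀ (norm_ne_zero_iff.2 (hx0 n))]
  obtain ⟨X, hX, φ, hφ, hlim⟩ :=
    (isCompact_sphere (0 : Matrix (Fin 2) (Fin 2) ℝ) 1).tendsto_subseq hs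
  have hxφ := hx.comp hφ.tendsto_atTop
  refine ⟨X, ?_, ?_, ?_⟩
  · refine mem_tangentSpace_of_tendsto _ (fun a ha => exists_left_inv_mem_matrixClosure ha)
      hxφ (fun n => hx0 _) (fun n => ?_) hlim
    obtain ⟨g, hg, hgx⟩ := hxΓ (φ n)
    exact hgx ▸ coe_mem_matrixClosure hg
  · rintro rfl
    simp at hX
  · have h1 := ((continuous_id (X := Matrix (Fin 2) (Fin 2) ℝ)).matrix_trace.tendsto X).comp hlim
    have h2 := (((continuous_id (X := Matrix (Fin 2) (Fin 2) ℝ)).matrix_det.tendsto X).comp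
      hlim).mul (tendsto_zero_iff_norm_tendsto_zero.1 hxφ)
    have h5 := h2.neg
    rw [mul_zero, neg_zero] at h5
    refine tendsto_nhds_unique h1 (h5.congr fun n => ?_)
    obtain ⟨g, hg, hgx⟩ := hxΓ (φ n)
    have h3 := trace_eq_neg_det_of_det_one_add (hgx ▸ g.det_coe)
    have h4 := norm_ne_zero_iff.2 (hx0 (φ n))
    simp only [Function.comp, id, Matrix.trace_smul, Matrix.det_smul, h3, Fintype.card_fin,
      smul_eq_mul]
    field_simp

lemma conj_mem_tangentSpace_matrixClosure {Γ : Subgroup SL(2, ℝ)} {X : Matrix (Fin 2) (Fin 2) ℝ}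
    (hX : X ∈ tangentSpace (matrixClosure Γ) (isClosed_matrixClosure Γ)) {g : SL(2, ℝ)}
    (hg : g ∈ Γ) :
    (g : Matrix (Fin 2) (Fin 2) ℝ) * X * ((g⁻¹ : SL(2, ℝ)) : Matrix (Fin 2) (Fin 2) ℝ) ∈
      tangentSpace (matrixClosure Γ) (isClosed_matrixClosure Γ) := by
  let u : (Matrix (Fin 2) (Fin 2) ℝ)ˣ :=
    ⟨g, (g⁻¹ : SL(2, ℝ)), by rw [← Matrix.SpecialLinearGroup.coe_mul]; simp,
      by rw [← Matrix.SpecialLinearGroup.coe_mul]; simp⟩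
  exact conj_mem_tangentSpace hX u (coe_mem_matrixClosure hg)
    (coe_mem_matrixClosure (Γ.inv_mem hg))

lemma one_add_mem_matrixClosure {Γ : Subgroup SL(2, ℝ)} {N : Matrix (Fin 2) (Fin 2) ℝ}
    (hN : N ∈ tangentSpace (matrixClosure Γ) (isClosed_matrixClosure Γ)) (hN2 : N * N = 0) :
    1 + N ∈ matrixClosure Γ := by
  have h := mem_tangentSpace.1 hN 1
  rwa [one_smul, exp_eq_one_add_of_mul_self_eq_zero hN2] at h

lemma dense_of_forall_mem_matrixClosure {Γ : Subgroup SL(2, ℝ)}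
    (h : ∀ g : SL(2, ℝ), (g : Matrix (Fin 2) (Fin 2) ℝ) ∈ matrixClosure Γ) :
    Dense (Γ : Set SL(2, ℝ)) :=
  fun g => closure_induced.2 (h g)

end ClosureInMatrices

lemma A_conj (r a b c d : ℝ) :
    (A r : Matrix (Fin 2) (Fin 2) ℝ) * !![a, b; c, d] *
      (((A r)⁻¹ : SL(2, ℝ)) : Matrix (Fin 2) (Fin 2) ℝ) =
    !![a, Real.exp r * b; (Real.exp r)⁻¹ * c, d] := by
  have h1 : Real.exp r = Real.exp (r / 2) * Real.exp (r / 2) := by rw [← Real.exp_add]; ring_nf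
  have h2 := Real.exp_ne_zero (r / 2)
  have hA : (A r : Matrix (Fin 2) (Fin 2) ℝ) =
      !![Real.exp (r / 2), 0; 0, Real.exp (-(r / 2))] := rfl
  rw [Matrix.SpecialLinearGroup.coe_inv, hA, Matrix.adjugate_fin_two_of, Real.exp_neg, h1]
  ext i j
  fin_cases i <;> fin_cases j <;> simp [Matrix.mul_apply] <;> field_simp

lemma R_conj (a b c : ℝ) :
    (R : Matrix (Fin 2) (Fin 2) ℝ) * !![a, b; c, -a] *
      ((R⁻¹ : SL(2, ℝ)) : Matrix (Fin 2) (Fin 2) ℝ) =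
    !![-((b + c) / 2), (2 * a + b - c) / 2; (2 * a + c - b) / 2, (b + c) / 2] := by
  have h : (Real.sqrt 2) ^ 2 = 2 := Real.sq_sqrt (by norm_num)
  have hR : (R : Matrix (Fin 2) (Fin 2) ℝ) = (Real.sqrt 2)⁻¹ • !![1, -1; 1, 1] := rfl
  rw [Matrix.SpecialLinearGroup.coe_inv, hR, Matrix.adjugate_fin_two]
  ext i j
  fin_cases i <;> fin_cases j <;> simp [Matrix.mul_apply] <;> field_simp <;> rw [h] <;> ring

theorem discrete_or_dense (r : ℝ) (hr : 0 < r) :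
    DiscreteTopology ↥(G r) ∨ Dense (G r : Set SL(2, ℝ)) := by
  refine or_iff_not_imp_left.2 fun hdisc => dense_of_forall_mem_matrixClosure fun g => ?_
  obtain ⟨X, hX, hX0, htr⟩ := exists_mem_tangentSpace_of_not_discreteTopology hdisc
  have hA : A r ∈ G r := Subgroup.subset_closure (by simp)
  have hR : R ∈ G r := Subgroup.subset_closure (by simp)
  have hXeta : X = !![X 0 0, X 0 1; X 1 0, -X 0 0] := by
    rw [Matrix.trace_fin_two] at htr
    rw [← eq_neg_of_add_eq_zero_right htr]
    exact Matrix.eta_fin_two X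
  have hne : X 0 0 ≠ 0 ∨ X 0 1 ≠ 0 ∨ X 1 0 ≠ 0 := by
    by_contra! h
    refine hX0 ?_
    rw [hXeta, h.1, h.2.1, h.2.2]
    ext i j
    fin_cases i <;> fin_cases j <;> simp
  rw [hXeta] at hX
  have hoff := offDiag_mem_of_invariant _ (Real.one_lt_exp_iff.2 hr)
    (fun a b c d h => A_conj r a b c d ▸ conj_mem_tangentSpace_matrixClosure h hA)
    (fun a b c h => R_conj a b c ▸ conj_mem_tangentSpace_matrixClosure h hR) hX hne
  refine mem_of_det_eq_one_of_transvection_mem _ (fun s => ?_) (fun t => ?_) _ g.det_coe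
  · convert one_add_mem_matrixClosure (hoff s 0) (offDiag_mul_self s 0 (mul_zero s)) using 1
    ext i j
    fin_cases i <;> fin_cases j <;> simp
  · convert one_add_mem_matrixClosure (hoff 0 t) (offDiag_mul_self 0 t (zero_mul t)) using 1
    ext i j
    fin_cases i <;> fin_cases j <;> simp
end

section
/- For every real x with 0 < x < π/4, one has 2·(1 + cos(4x))·sin(x) < sin(4x); equivalently, 4·sin(x)²·(1 + cos(4x))² < sin(4x)². -/
open Real

theorem trig_inequality (x : ℝ) (hx0 : 0 < x) (hx : x < π / 4) :
    2 * (1 + Real.cos (4 * x)) * Real.sin x < Real.sin (4 * x) ∧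
      4 * Real.sin x ^ 2 * (1 + Real.cos (4 * x)) ^ 2 < Real.sin (4 * x) ^ 2 := by
  have hs : 0 < sin x := sin_pos_of_pos_of_lt_pi hx0 (by linarith)
  have hC : 0 < cos (2 * x) := cos_pos_of_mem_Ioo ⟨by linarith, by linarith⟩
  have hlt : cos (2 * x) < cos x :=
    cos_lt_cos_of_nonneg_of_le_pi hx0.le (by linarith) (by linarith)
  have hcos : 1 + cos (4 * x) = 2 * cos (2 * x) ^ 2 := by
    rw [show 4 * x = 2 * (2 * x) by ring, cos_two_mul (2 * x)]
    ring
  have hsin : sin (4 * x) = 4 * (sin x * cos (2 * x)) * cos x := by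
    rw [show 4 * x = 2 * (2 * x) by ring, sin_two_mul (2 * x), sin_two_mul x]
    ring
  have key : 2 * (1 + cos (4 * x)) * sin x < sin (4 * x) := by
    rw [hcos, hsin]
    calc 2 * (2 * cos (2 * x) ^ 2) * sin x = 4 * (sin x * cos (2 * x)) * cos (2 * x) := by ring
      _ < 4 * (sin x * cos (2 * x)) * cos x := by gcongr
  refine ⟨key, ?_⟩
  have hnonneg : 0 ≤ 2 * (1 + cos (4 * x)) * sin x := by
    rw [hcos]
    positivity
  calc 4 * sin x ^ 2 * (1 + cos (4 * x)) ^ 2 = (2 * (1 + cos (4 * x)) * sin x) ^ 2 := by ring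
    _ < sin (4 * x) ^ 2 := by gcongr
end

section
/- For all integers p and q with q ≥ 2 and p > 4q, one has 4·sin(π/p)²·((1 + cos(2πq/p)) / sin(2πq/p))² < 1. (Note 0 < 2πq/p < π/2, so the denominator sin(2πq/p) is positive.) -/
open Real

theorem jorgensen_quantity_lt_one (p q : ℤ) (hq : 2 ≤ q) (hp : 4 * q < p) :
    4 * Real.sin (π / p) ^ 2 *
      ((1 + Real.cos (2 * π * q / p)) / Real.sin (2 * π * q / p)) ^ 2 < 1 := by
  have hq' : (2 : ℝ) ≤ q := by exact_mod_cast hq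
  have hp' : 4 * (q : ℝ) < p := by exact_mod_cast hp
  have hp0 : (0 : ℝ) < p := by linarith
  obtain ⟨a, ha⟩ : ∃ a, a = π / (p : ℝ) := ⟨_, rfl⟩
  have ha0 : 0 < a := ha ▸ div_pos pi_pos hp0
  have hap : a * p = π := by rw [ha]; field_simp
  obtain ⟨x, hx⟩ : ∃ x, x = q * a := ⟨_, rfl⟩
  have hx2 : 2 * a ≤ x := by rw [hx]; gcongr
  have hx4 : 4 * x < π := by
    rw [hx, ← hap]
    nlinarith [mul_lt_mul_of_pos_left hp' ha0]
  have harg : 2 * π * q / p = 2 * x := by rw [hx, ha]; ring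
  have hsin_a : 0 < sin a := sin_pos_of_pos_of_lt_pi ha0 (by linarith)
  have hsin_x : 0 < sin x := sin_pos_of_pos_of_lt_pi (by linarith) (by linarith)
  have hcos_x : 0 < cos x := cos_pos_of_mem_Ioo ⟨by linarith, by linarith⟩
  have hcos : cos x < cos a :=
    cos_lt_cos_of_nonneg_of_le_pi ha0.le (by linarith) (by linarith)
  have hsin : sin (2 * a) ≤ sin x :=
    sin_le_sin_of_le_of_le_pi_div_two (by linarith) (by linarith) hx2
  rw [sin_two_mul] at hsin
  have key : 2 * sin a * cos x < sin x :=
    (mul_lt_mul_of_pos_left hcos (by positivity)).trans_le hsin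
  have hcot : (1 + cos (2 * x)) / sin (2 * x) = cos x / sin x := by
    rw [cos_two_mul, sin_two_mul]
    field_simp
    ring
  rw [harg, ← ha, hcot]
  calc 4 * sin a ^ 2 * (cos x / sin x) ^ 2 = (2 * sin a * cos x / sin x) ^ 2 := by ring
    _ < 1 := pow_lt_one₀ (by positivity) ((div_lt_one hsin_x).2 key) two_ne_zero
end
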